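/- arXiv:1505.00883 — 4 statements merged into one kernel-verified Lean document; each statement's English description precedes it below -/
import Mathlib

section
/- Let p be a prime and d ≥ 1. If E ⊆ (ZMod p)^d is a spectral set (with some spectrum A) and |E| > p^{d−1}, then E = (ZMod p)^d. -/
open Finset

/-- The additive character `χ(u) = exp(2πi u / p)` on `ZMod p`. -/
noncomputable def chi (p : ℕ) (u : ZMod p) : ℂ :=
  Complex.exp (2 * Real.pi * Complex.I * (u.val : ℂ) / (p : ℂ))

/-- Dot product on `(ZMod p)^d`. -/
def dotp {p d : ℕ} (x m : Fin d → ZMod p) : ZMod p := ∑ j, x j * m j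

/-- `(E, A)` is a spectral pair: `A` indexes an orthogonal basis of exponentials for `L²(E)`. -/
def IsSpectralPair (p d : ℕ) (E A : Finset (Fin d → ZMod p)) : Prop :=
  (∀ f : (Fin d → ZMod p) → ℂ, ∃ c : (Fin d → ZMod p) → ℂ,
      ∀ x ∈ E, f x = ∑ a ∈ A, c a * chi p (dotp x a)) ∧
  (∀ a ∈ A, ∀ a' ∈ A, a ≠ a' → ∑ x ∈ E, chi p (dotp x (a - a')) = 0)

/-- `(E, T)` is a tiling pair: every vector has a unique representation `e + t`. -/
def IsTilingPair (p d : ℕ) (E T : Finset (Fin d → ZMod p)) : Prop :=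
  ∀ v : Fin d → ZMod p, ∃! et : (Fin d → ZMod p) × (Fin d → ZMod p),
    et.1 ∈ E ∧ et.2 ∈ T ∧ v = et.1 + et.2

/-- `E` tiles `(ZMod p)^d` by translation. -/
def Tiles (p d : ℕ) (E : Finset (Fin d → ZMod p)) : Prop :=
  ∃ T : Finset (Fin d → ZMod p), IsTilingPair p d E T

lemma chi_eq_stdAddChar (p : ℕ) [Fact p.Prime] (u : ZMod p) : chi p u = ZMod.stdAddChar u := by
  have h := ZMod.stdAddChar_coe (N := p) (u.val : ℤ)
  rw [Int.cast_natCast, ZMod.natCast_zmod_val] at h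
  rw [h, chi, Int.cast_natCast]

lemma chi_mul (p : ℕ) [Fact p.Prime] (t u : ZMod p) :
    chi p (t * u) = (chi p 1 ^ t.val) ^ u.val := by
  rw [chi_eq_stdAddChar, chi_eq_stdAddChar, ← pow_mul, ← AddChar.map_nsmul_eq_pow]
  simp

lemma isPrimitiveRoot_chi_one (p : ℕ) [hp : Fact p.Prime] : IsPrimitiveRoot (chi p 1) p := by
  have h := Complex.isPrimitiveRoot_exp p hp.out.ne_zero
  have : Fact (1 < p) := ⟨hp.out.one_lt⟩
  simpa [chi, ZMod.val_one] using h

/-- Vanishing of an exponential sum is invariant under nonzero dilation of the frequency. -/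
lemma sum_chi_eq_zero_of_mul {ι : Type*} (p : ℕ) [hp : Fact p.Prime] (E : Finset ι)
    (g : ι → ZMod p) {t : ZMod p} (ht : t ≠ 0) (h : ∑ x ∈ E, chi p (t * g x) = 0) :
    ∑ x ∈ E, chi p (g x) = 0 := by
  have hζ := isPrimitiveRoot_chi_one p
  have hcop : t.val.Coprime p := by
    rw [Nat.coprime_comm, hp.out.coprime_iff_not_dvd, ← ZMod.natCast_eq_zero_iff,
      ZMod.natCast_zmod_val]
    exact ht
  let P : Polynomial ℤ := ∑ x ∈ E, Polynomial.X ^ (g x).val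
  have hP : Polynomial.aeval (chi p 1 ^ t.val) P = 0 := by
    simpa [P, map_sum, chi_mul] using h
  have hint : IsIntegral ℤ (chi p 1 ^ t.val) := (hζ.isIntegral hp.out.pos).pow _
  have hdvd : minpoly ℤ (chi p 1) ∣ P := by
    rw [hζ.minpoly_eq_pow_coprime hcop]
    exact minpoly.isIntegrallyClosed_dvd hint hP
  obtain ⟨Q, hQ⟩ := hdvd
  have h1 : Polynomial.aeval (chi p 1) P = 0 := by
    rw [hQ, map_mul, minpoly.aeval, zero_mul]
  have h2 : ∀ u : ZMod p, chi p u = chi p 1 ^ u.val := fun u => by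
    have : Fact (1 < p) := ⟨hp.out.one_lt⟩
    simpa [ZMod.val_one] using chi_mul p 1 u
  rw [← h1]
  simp only [P, map_sum, map_pow, Polynomial.aeval_X]
  exact sum_congr rfl fun x _ => h2 _

lemma IsSpectralPair.card_le {p d : ℕ} {E A : Finset (Fin d → ZMod p)}
    (h : IsSpectralPair p d E A) : E.card ≤ A.card := by
  classical
  let M : Matrix E A ℂ := Matrix.of fun x a => chi p (dotp x.1 a.1)
  have hsurj : Function.Surjective M.mulVecLin := by
    intro f
    obtain ⟨c, hc⟩ := h.1 fun x => if hx : x ∈ E then f ⟨x, hx⟩ else 0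
    refine ⟨fun a => c a, funext fun x => ?_⟩
    have hx := hc x x.2
    simp only [x.2, dite_true, Subtype.coe_eta] at hx
    rw [hx, ← sum_coe_sort A]
    simp [M, Matrix.mulVec, dotProduct, mul_comm]
  simpa using LinearMap.finrank_le_finrank_of_surjective hsurj

/-- A set of more than `p ^ (d - 1)` points determines every direction. -/
lemma exists_sub_eq_smul {p d : ℕ} [Fact p.Prime] {A : Finset (Fin d → ZMod p)}
    (hA : p ^ (d - 1) < A.card) {m : Fin d → ZMod p} (hm : m ≠ 0) :
    ∃ a ∈ A, ∃ a' ∈ A, a ≠ a' ∧ ∃ t : ZMod p, t ≠ 0 ∧ a - a' = t • m := by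
  obtain ⟨j, hj⟩ := Function.ne_iff.mp hm
  let F : (Fin d → ZMod p) → ({i : Fin d // i ≠ j} → ZMod p) :=
    fun a i => a i - a j / m j * m i
  have hcard : (univ : Finset ({i : Fin d // i ≠ j} → ZMod p)).card < A.card := by
    simpa [ZMod.card, Fintype.card_subtype_compl] using hA
  obtain ⟨a, ha, a', ha', hne, heq⟩ :=
    exists_ne_map_eq_of_card_lt_of_maps_to hcard (f := F) fun _ _ => mem_coe.2 (mem_univ _)
  have hsub : a - a' = ((a j - a' j) / m j) • m := by
    funext i
    by_cases hi : i = j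
    · subst hi
      simp only [Pi.sub_apply, Pi.smul_apply, smul_eq_mul]
      exact (div_mul_cancel₀ _ hj).symm
    · have := congrFun heq ⟨i, hi⟩
      simp only [F] at this
      simp only [Pi.sub_apply, Pi.smul_apply, smul_eq_mul, sub_div]
      linear_combination this
  refine ⟨a, ha, a', ha', hne, _, ?_, hsub⟩
  intro h0
  rw [h0, zero_smul, sub_eq_zero] at hsub
  exact hne hsub

lemma sum_chi_dotp_eq_zero {p d : ℕ} [Fact p.Prime] {y : Fin d → ZMod p} (hy : y ≠ 0) :
    ∑ m, chi p (dotp y m) = 0 := by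
  obtain ⟨j, hj⟩ := Function.ne_iff.mp hy
  let φ : (Fin d → ZMod p) →+ ZMod p :=
    { toFun := dotp y
      map_zero' := by simp [dotp]
      map_add' := fun a b => by simp [dotp, mul_add, sum_add_distrib] }
  have hne : (ZMod.stdAddChar (N := p)).compAddMonoidHom φ ≠ 1 := by
    intro h
    have h1 := DFunLike.congr_fun h (Pi.single j (y j)⁻¹)
    have h2 : φ (Pi.single j (y j)⁻¹) = 1 := by
      change dotp y (Pi.single j (y j)⁻¹) = 1
      simp only [dotp, Pi.single_apply, mul_ite, mul_zero, sum_ite_eq', mem_univ, if_true]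
      exact mul_inv_cancel₀ hj
    rw [AddChar.compAddMonoidHom_apply, h2, AddChar.one_apply,
      ← AddChar.map_zero_eq_one (ZMod.stdAddChar (N := p))] at h1
    exact one_ne_zero (ZMod.injective_stdAddChar h1)
  simp only [chi_eq_stdAddChar]
  exact AddChar.sum_eq_zero_of_ne_one hne

theorem spectral_large_implies_univ (p d : ℕ) [hp : Fact p.Prime] (hd : 1 ≤ d)
    (E : Finset (Fin d → ZMod p))
    (hspec : ∃ A : Finset (Fin d → ZMod p), IsSpectralPair p d E A)
    (hcard : E.card > p ^ (d - 1)) :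
    E = Finset.univ := by
  obtain ⟨A, hA⟩ := hspec
  have hvanish : ∀ m : Fin d → ZMod p, m ≠ 0 → ∑ x ∈ E, chi p (dotp x m) = 0 := by
    intro m hm
    obtain ⟨a, ha, a', ha', hne, t, ht, hsub⟩ :=
      exists_sub_eq_smul (hcard.trans_le hA.card_le) hm
    have h := hA.2 a ha a' ha' hne
    refine sum_chi_eq_zero_of_mul p E (fun x => dotp x m) ht ?_
    rw [← h, hsub]
    refine sum_congr rfl fun x _ => congrArg _ ?_
    simp only [dotp, mul_sum, Pi.smul_apply, smul_eq_mul]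
    exact sum_congr rfl fun i _ => by ring
  refine eq_univ_iff_forall.2 fun y => ?_
  by_contra hy
  have hzero : ∑ x ∈ E, ∑ m, chi p (dotp (x - y) m) = 0 :=
    sum_eq_zero fun x hx => sum_chi_dotp_eq_zero (sub_ne_zero.2 fun h => hy (h ▸ hx))
  have hsplit : ∀ x m : Fin d → ZMod p,
      chi p (dotp (x - y) m) = chi p (dotp x m) * chi p (-dotp y m) := fun x m => by
    simp only [chi_eq_stdAddChar, ← AddChar.map_add_eq_mul]
    simp [dotp, sub_mul, ← sub_eq_add_neg]
  rw [sum_comm, sum_eq_single (0 : Fin d → ZMod p)] at hzero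
  · have : E.card = 0 := by simpa [dotp, chi] using hzero
    omega
  · intro m _ hm
    simp only [hsplit, ← sum_mul, hvanish m hm, zero_mul]
  · simp
end

section
/- Let p be a prime and d ≥ 1. If E ⊆ (ZMod p)^d is a spectral set (with some spectrum A), then either |E| = 1 or p divides |E|. -/
open Finset

open Polynomial in
/-- A vanishing sum of `p`-th roots of unity, `p` prime, has a number of terms divisible by `p`. -/
theorem IsPrimitiveRoot.prime_dvd_card_of_sum_pow_eq_zero {K ι : Type*} [Field K] [CharZero K]
    {p : ℕ} (hp : p.Prime) {ζ : K} (hζ : IsPrimitiveRoot ζ p) (s : Finset ι) (n : ι → ℕ)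
    (h : ∑ i ∈ s, ζ ^ n i = 0) : p ∣ s.card := by
  have : Fact p.Prime := ⟨hp⟩
  have hdvd : cyclotomic p ℤ ∣ ∑ i ∈ s, (X : ℤ[X]) ^ n i := by
    rw [cyclotomic_eq_minpoly hζ hp.pos]
    exact minpoly.isIntegrallyClosed_dvd (hζ.isIntegral hp.pos) (by simpa using h)
  have h1 := eval_dvd (x := 1) hdvd
  rw [eval_one_cyclotomic_prime] at h1
  simp only [eval_finsetSum, eval_pow, eval_X, one_pow, sum_const, nsmul_eq_mul, mul_one] at h1
  exact_mod_cast h1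

theorem chi_eq_pow (p : ℕ) (u : ZMod p) :
    chi p u = Complex.exp (2 * Real.pi * Complex.I / p) ^ u.val := by
  rw [chi, ← Complex.exp_nat_mul]
  congr 1
  ring

theorem chi_ne_zero (p : ℕ) (u : ZMod p) : chi p u ≠ 0 := Complex.exp_ne_zero _

theorem prime_dvd_card_of_sum_chi_eq_zero {ι : Type*} {p : ℕ} (hp : p.Prime) (s : Finset ι)
    (u : ι → ZMod p) (h : ∑ i ∈ s, chi p (u i) = 0) : p ∣ s.card :=
  (Complex.isPrimitiveRoot_exp p hp.ne_zero).prime_dvd_card_of_sum_pow_eq_zero hp s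
    (fun i => (u i).val) (by simpa only [chi_eq_pow] using h)

theorem IsSpectralPair.card_le_one {p d : ℕ} {E A : Finset (Fin d → ZMod p)}
    (h : IsSpectralPair p d E A) (hA : A.card ≤ 1) : E.card ≤ 1 := by
  rw [Finset.card_le_one]
  intro x hx y hy
  by_contra hxy
  obtain ⟨c, hc⟩ := h.1 (Pi.single x 1)
  have hcx := hc x hx
  have hcy := hc y hy
  rw [Pi.single_eq_same] at hcx
  rw [Pi.single_eq_of_ne (Ne.symm hxy)] at hcy
  obtain ⟨a, ha⟩ := Finset.card_le_one_iff_subset_singleton.mp hA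
  obtain rfl | rfl := Finset.subset_singleton_iff.mp ha
  · simp at hcx
  · simp_all [chi_ne_zero]

theorem spectral_card_one_or_p_dvd (p d : ℕ) (hp : p.Prime) (hd : 1 ≤ d)
    (E : Finset (Fin d → ZMod p))
    (hspec : ∃ A : Finset (Fin d → ZMod p), IsSpectralPair p d E A) :
    E.card = 1 ∨ p ∣ E.card := by
  obtain ⟨A, hA⟩ := hspec
  rcases le_or_gt A.card 1 with h | h
  · rcases Nat.le_one_iff_eq_zero_or_eq_one.mp (hA.card_le_one h) with h0 | h1
    · exact Or.inr (h0 ▸ dvd_zero p)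
    · exact Or.inl h1
  · obtain ⟨a, ha, a', ha', hne⟩ := Finset.one_lt_card.mp h
    exact Or.inr (prime_dvd_card_of_sum_chi_eq_zero hp E _ (hA.2 a ha a' ha' hne))
end

section
/- (Vanishing Fourier coefficient equals equidistribution) Let p be a prime, d ≥ 1, E ⊆ (ZMod p)^d, and m ∈ (ZMod p)^d with m ≠ 0. Then Σ_{x∈E} χ(x·m) = 0 if and only if the function t ↦ |E ∩ {x ∈ (ZMod p)^d : x·m = t}| is constant in t ∈ ZMod p, i.e., E is equidistributed on the p parallel hyperplanes {x : x·m = t}. -/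
open Finset

theorem sum_chi_eq_sum_card_mul_chi {α : Type*} (p : ℕ) [NeZero p] (E : Finset α)
    (f : α → ZMod p) :
    ∑ x ∈ E, chi p (f x) = ∑ t : ZMod p, ((E.filter fun x => f x = t).card : ℂ) * chi p t := by
  rw [← Finset.sum_fiberwise E f]
  refine Finset.sum_congr rfl fun t _ => ?_
  rw [Finset.sum_congr rfl fun x hx => congrArg (chi p) (Finset.mem_filter.mp hx).2,
    Finset.sum_const, nsmul_eq_mul]

/-- A natural-number combination of the values of `chi` vanishes iff its coefficients are all equal. -/
theorem sum_natCast_mul_chi_eq_zero_iff {p : ℕ} [NeZero p] (hp : p.Prime) (c : ZMod p → ℕ) :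
    ∑ t : ZMod p, (c t : ℂ) * chi p t = 0 ↔ ∀ t t', c t = c t' := by
  have hζ := Complex.isPrimitiveRoot_exp p hp.ne_zero
  obtain ⟨n, rfl⟩ := Nat.exists_eq_succ_of_ne_zero hp.ne_zero
  have key := hζ.sum_eq_zero_iff_forall_eq_int hp (fun i : Fin (n + 1) => (c i : ℤ))
  simp only [Nat.cast_inj, Int.cast_natCast] at key
  simp only [chi_eq_pow]
  exact key

theorem fourier_zero_iff_equidistributed (p d : ℕ) (hp : p.Prime) (hd : 1 ≤ d)
    (E : Finset (Fin d → ZMod p)) (m : Fin d → ZMod p) (hm : m ≠ 0) :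
    (∑ x ∈ E, chi p (dotp x m) = 0) ↔
      ∀ t t' : ZMod p,
        (E.filter fun x => dotp x m = t).card = (E.filter fun x => dotp x m = t').card := by
  have : NeZero p := ⟨hp.ne_zero⟩
  rw [sum_chi_eq_sum_card_mul_chi p E fun x => dotp x m]
  exact sum_natCast_mul_chi_eq_zero_iff hp fun t => (E.filter fun x => dotp x m = t).card
end

section
/- Let p be a prime, E ⊆ (ZMod p)² with |E| = p, and suppose there is a nonzero m ∈ (ZMod p)² with Σ_{x∈E} χ(x·m) = 0. Let L⊥ = { x ∈ (ZMod p)² : x·m = 0 } be the line through the origin perpendicular to m. Then (E, L⊥) is a tiling pair: every v ∈ (ZMod p)² has a unique representation v = e + w with e ∈ E and w ∈ L⊥. -/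
open Finset

/-- A rational linear relation among the powers `1, ζ, …, ζ ^ (p - 1)` of a primitive `p`-th root
of unity, `p` prime, has constant coefficients. -/
theorem IsPrimitiveRoot.coeff_eq_of_sum_eq_zero {K : Type*} [Field K] [CharZero K] {p : ℕ}
    [hp : Fact p.Prime] {ζ : K} (hζ : IsPrimitiveRoot ζ p) (f : ℕ → ℚ)
    (h : ∑ i ∈ range p, (f i : K) * ζ ^ i = 0) {i : ℕ} (hi : i < p) : f i = f (p - 1) := by
  have hpos := hp.out.pos
  set P : Polynomial ℚ := ∑ i ∈ range p, Polynomial.monomial i (f i - f (p - 1)) with hP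
  have hcoeff : ∀ n, P.coeff n = if n < p then f n - f (p - 1) else 0 := by
    intro n
    simp only [hP, Polynomial.finsetSum_coeff, Polynomial.coeff_monomial, sum_ite_eq', mem_range]
  have hroot : Polynomial.aeval ζ P = 0 := by
    simp only [hP, map_sum, Polynomial.aeval_monomial, map_sub, sum_sub_distrib,
      ← mul_sum, eq_ratCast, h, hζ.geom_sum_eq_zero hp.out.one_lt, mul_zero, sub_zero]
  have hdvd : Polynomial.cyclotomic p ℚ ∣ P := by
    rw [Polynomial.cyclotomic_eq_minpoly_rat hζ hpos]
    exact minpoly.dvd ℚ ζ hroot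
  have hdeg : P.degree < (Polynomial.cyclotomic p ℚ).degree := by
    rw [Polynomial.degree_cyclotomic, Nat.totient_prime hp.out, Polynomial.degree_lt_iff_coeff_zero]
    intro n hn
    rw [hcoeff]
    split_ifs with hnp
    · rw [show n = p - 1 by omega, sub_self]
    · rfl
  have hzero := Polynomial.eq_zero_of_dvd_of_degree_lt hdvd hdeg
  have hi' := hcoeff i
  rw [hzero, Polynomial.coeff_zero, if_pos hi] at hi'
  exact sub_eq_zero.mp hi'.symm

/-- If a character sum over a finite set vanishes, all fibres of the phase have the same size. -/
theorem card_fiber_eq_of_sum_chi_eq_zero {p : ℕ} [hp : Fact p.Prime] {α : Type*} (E : Finset α)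
    (φ : α → ZMod p) (h : ∑ x ∈ E, chi p (φ x) = 0) (a b : ZMod p) :
    (E.filter fun x => φ x = a).card = (E.filter fun x => φ x = b).card := by
  have hζ := Complex.isPrimitiveRoot_exp p hp.out.ne_zero
  have hsum : ∑ i ∈ range p, (((E.filter fun x => (φ x).val = i).card : ℚ) : ℂ) *
      Complex.exp (2 * Real.pi * Complex.I / p) ^ i = 0 := by
    rw [← h, ← sum_fiberwise_of_maps_to (t := range p) (g := fun x => (φ x).val)
      fun x _ => mem_range.mpr (ZMod.val_lt _)]
    refine sum_congr rfl fun i _ => ?_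
    rw [sum_congr rfl fun x hx => by rw [chi_eq_pow, (mem_filter.mp hx).2], sum_const,
      nsmul_eq_mul, Rat.cast_natCast]
  have key : ∀ c : ZMod p, (E.filter fun x => φ x = c).card =
      (E.filter fun x => (φ x).val = p - 1).card := by
    intro c
    have := hζ.coeff_eq_of_sum_eq_zero _ hsum (ZMod.val_lt c)
    simpa only [(ZMod.val_injective p).eq_iff, Nat.cast_inj] using this
  rw [key a, key b]

/-- If moreover the set has `p` elements, the phase takes every value exactly once. -/
theorem existsUnique_of_sum_chi_eq_zero {p : ℕ} [hp : Fact p.Prime] {α : Type*} (E : Finset α)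
    (hcard : E.card = p) (φ : α → ZMod p) (h : ∑ x ∈ E, chi p (φ x) = 0) (a : ZMod p) :
    ∃! x, x ∈ E ∧ φ x = a := by
  have hsum : E.card = ∑ b : ZMod p, (E.filter fun x => φ x = b).card :=
    card_eq_sum_card_fiberwise fun x _ => mem_coe.mpr (mem_univ _)
  rw [sum_congr rfl fun b _ => card_fiber_eq_of_sum_chi_eq_zero E φ h b a, sum_const, card_univ,
    ZMod.card, smul_eq_mul, hcard] at hsum
  obtain ⟨x, hx⟩ := card_eq_one.mp (Nat.eq_of_mul_eq_mul_left hp.out.pos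
    (hsum.symm.trans (mul_one p).symm))
  simp only [Finset.ext_iff, mem_filter, mem_singleton] at hx
  exact ⟨x, (hx x).mpr rfl, fun y hy => (hx y).mp hy⟩

theorem dotp_sub {p d : ℕ} (x y m : Fin d → ZMod p) :
    dotp (x - y) m = dotp x m - dotp y m := by
  simp [dotp, sub_mul]

theorem tiling_by_perp_line (p : ℕ) [hp : Fact p.Prime]
    (E : Finset (Fin 2 → ZMod p)) (hcard : E.card = p)
    (m : Fin 2 → ZMod p) (hm : m ≠ 0)
    (hzero : ∑ x ∈ E, chi p (dotp x m) = 0) :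
    IsTilingPair p 2 E (Finset.univ.filter fun x => dotp x m = 0) := by
  intro v
  obtain ⟨e, ⟨heE, he⟩, huniq⟩ :=
    existsUnique_of_sum_chi_eq_zero E hcard (fun x => dotp x m) hzero (dotp v m)
  refine ⟨(e, v - e), ⟨heE, ?_, (add_sub_cancel e v).symm⟩, ?_⟩
  · simp only [mem_filter, mem_univ, true_and, dotp_sub, sub_eq_zero]
    exact he.symm
  · rintro ⟨e', t⟩ ⟨he', ht, hv⟩
    obtain rfl : t = v - e' := eq_sub_of_add_eq' hv.symm
    simp only [mem_filter, mem_univ, true_and, dotp_sub, sub_eq_zero] at ht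
    rw [huniq e' ⟨he', ht.symm⟩]
end
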